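/- arXiv:0912.2423 — 2 statements merged into one kernel-verified Lean document; each statement's English description precedes it below -/
import Mathlib

section
/- Let α ∈ (0,1), β ∈ (0, 1−α) with α + β ≤ 0.59. Let σ_{(1)} ≤ σ_{(2)} ≤ … ≤ σ_{(n)} be the ordered standard deviations and Σ_{l,k}² = Σ_{j=l+1}^{l+k} σ_{(j)}². Define ρ_{k,n}² = [ max_{0 ≤ l ≤ n−k} Σ_{l,k}² ln(1 + ((n−l)/k²) ∨ √((n−l)/k²)) ] ∨ (Σ_{j=n−k+1}^n σ_{(j)}⁴)^{1/2}. Then for every level-α test Φ_α, inf_{θ ∈ S_{k,n}, ‖θ‖₂ ≥ ρ_{k,n}} P_θ(Φ_α = 1) ≤ 1 − β. Consequently the (α,β) minimax rate of testing over S_{k,n} with respect to the l₂ norm satisfies ρ₂(S_{k,n}, α, β) ≥ ρ_{k,n}. -/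
open MeasureTheory ProbabilityTheory ENNReal Finset

noncomputable section

/-- Distribution of the observation `Y = (Y_j)_{1 ≤ j ≤ N}` in the heteroscedastic Gaussian
sequence model `Y_j = θ_j + σ_j ε_j` (the coordinate `j : Fin N` represents the index `j+1`). -/
def gaussP (N : ℕ) (σ θ : Fin N → ℝ) : Measure (Fin N → ℝ) :=
  Measure.pi fun j => gaussianReal (θ j) (Real.toNNReal (σ j ^ 2))

/-- The `l₂` norm of a vector. -/
def l2norm (N : ℕ) (θ : Fin N → ℝ) : ℝ := Real.sqrt (∑ j, θ j ^ 2)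

/-- A level-`α` test of the null hypothesis `θ = 0`. -/
def IsLevelTest (N : ℕ) (σ : Fin N → ℝ) (α : ℝ) (Φ : (Fin N → ℝ) → Bool) : Prop :=
  Measurable Φ ∧ gaussP N σ 0 {y | Φ y = true} ≤ ENNReal.ofReal α

/-- Uniform separation rate of the test `Φ` over the class `F`, w.r.t. the `l₂` norm. -/
def sepRate (N : ℕ) (σ : Fin N → ℝ) (Φ : (Fin N → ℝ) → Bool) (F : Set (Fin N → ℝ))
    (β : ℝ) : ℝ≥0∞ :=
  sInf {ρ : ℝ≥0∞ | 0 < ρ ∧ ∀ θ ∈ F, ρ ≤ ENNReal.ofReal (l2norm N θ) →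
    ENNReal.ofReal (1 - β) < gaussP N σ θ {y | Φ y = true}}

/-- The `(α,β)` minimax rate of testing over the class `F`, w.r.t. the `l₂` norm. -/
def minimaxRate (N : ℕ) (σ : Fin N → ℝ) (F : Set (Fin N → ℝ)) (α β : ℝ) : ℝ≥0∞ :=
  sInf {r : ℝ≥0∞ | ∃ Φ : (Fin N → ℝ) → Bool, IsLevelTest N σ α Φ ∧ r = sepRate N σ Φ F β}

/-- Sum of `f j` over the (1-indexed) indices `1 ≤ j ≤ D`. -/
def lowSum (N D : ℕ) (f : Fin N → ℝ) : ℝ :=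
  ∑ j ∈ Finset.univ.filter (fun j : Fin N => (j : ℕ) < D), f j

/-- The set `S_{k,n}` of signals vanishing after the (1-indexed) rank `n` and having at most
`k` non-zero coefficients. -/
def Skn (N n k : ℕ) : Set (Fin N → ℝ) :=
  {θ | (∀ j : Fin N, n ≤ (j : ℕ) → θ j = 0) ∧ {j : Fin N | θ j ≠ 0}.ncard ≤ k}

/-- `Σ_{l,k}² = σ_{(l+1)}² + … + σ_{(l+k)}²`, where `σs` is the (0-indexed) non-decreasing
rearrangement of the standard deviations. -/
def SigmaSq (σs : ℕ → ℝ) (l k : ℕ) : ℝ := ∑ j ∈ Finset.Ico l (l + k), σs j ^ 2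

section LowerBound

/-- Likelihood ratio of `gaussianReal m v` with respect to `gaussianReal 0 v`. -/
def gaussLR (m v x : ℝ) : ℝ := Real.exp (m / v * x - m ^ 2 / (2 * v))

lemma integrable_gaussLR (m w : ℝ) (v : NNReal) : Integrable (gaussLR m w) (gaussianReal 0 v) := by
  unfold gaussLR
  simp_rw [Real.exp_sub]
  exact (integrable_exp_mul_gaussianReal (m / w)).div_const _

lemma gaussLR_mul (a b v x : ℝ) (hv : v ≠ 0) :
    gaussLR a v x * gaussLR b v x = Real.exp (a * b / v) * gaussLR (a + b) v x := by
  unfold gaussLR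
  rw [← Real.exp_add, ← Real.exp_add]
  congr 1
  field_simp
  ring

lemma integral_gaussLR (m : ℝ) {v : NNReal} (hv : v ≠ 0) :
    ∫ x, gaussLR m v x ∂(gaussianReal 0 v) = 1 := by
  unfold gaussLR
  have h := congrFun (mgf_id_gaussianReal (μ := 0) (v := v)) (m / v)
  simp only [mgf, id] at h
  simp_rw [Real.exp_sub]
  rw [integral_div, h, ← Real.exp_sub, Real.exp_eq_one_iff]
  have : (v : ℝ) ≠ 0 := by exact_mod_cast hv
  field_simp
  ring

lemma gaussianReal_eq_withDensity_gaussLR (m : ℝ) {v : NNReal} (hv : v ≠ 0) :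
    gaussianReal m v = (gaussianReal 0 v).withDensity fun x => ENNReal.ofReal (gaussLR m v x) := by
  rw [gaussianReal_of_var_ne_zero m hv, gaussianReal_of_var_ne_zero 0 hv, ← withDensity_mul]
  · congr 1
    ext x
    simp only [Pi.mul_apply, gaussianPDF, gaussianPDFReal, gaussLR]
    rw [← ENNReal.ofReal_mul (by positivity), mul_assoc _ (Real.exp _), ← Real.exp_add]
    congr 3
    have : (v : ℝ) ≠ 0 := by exact_mod_cast hv
    field_simp
    ring
  · exact measurable_gaussianPDF _ _
  · unfold gaussLR
    fun_prop

/-- Likelihood ratio of `gaussP N σ θ` with respect to `gaussP N σ 0`. -/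
def seqLR (N : ℕ) (σ θ y : Fin N → ℝ) : ℝ := ∏ j, gaussLR (θ j) (σ j ^ 2) (y j)

instance (N : ℕ) (σ θ : Fin N → ℝ) : IsProbabilityMeasure (gaussP N σ θ) := by
  unfold gaussP
  infer_instance

variable {N : ℕ} {σ : Fin N → ℝ}

lemma integrable_seqLR (θ : Fin N → ℝ) : Integrable (seqLR N σ θ) (gaussP N σ 0) :=
  Integrable.fintype_prod fun j => integrable_gaussLR (θ j) (σ j ^ 2) _

lemma seqLR_nonneg (θ y : Fin N → ℝ) : 0 ≤ seqLR N σ θ y :=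
  Finset.prod_nonneg fun _ _ => (Real.exp_pos _).le

lemma integral_seqLR (hσ : ∀ j, 0 < σ j) (θ : Fin N → ℝ) :
    ∫ y, seqLR N σ θ y ∂(gaussP N σ 0) = 1 := by
  unfold seqLR gaussP
  rw [integral_fintype_prod_eq_prod (fun j x => gaussLR (θ j) (σ j ^ 2) x)]
  refine Finset.prod_eq_one fun j _ => ?_
  have hj := pow_pos (hσ j) 2
  have h := integral_gaussLR (θ j) (v := Real.toNNReal (σ j ^ 2)) (by simpa using (hσ j).ne')
  rwa [Real.coe_toNNReal _ hj.le] at h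

lemma seqLR_mul (hσ : ∀ j, 0 < σ j) (θ η y : Fin N → ℝ) :
    seqLR N σ θ y * seqLR N σ η y =
      Real.exp (∑ j, θ j * η j / σ j ^ 2) * seqLR N σ (θ + η) y := by
  unfold seqLR
  rw [Real.exp_sum, ← Finset.prod_mul_distrib, ← Finset.prod_mul_distrib]
  exact Finset.prod_congr rfl fun j _ => gaussLR_mul _ _ _ _ (pow_pos (hσ j) 2).ne'

lemma gaussP_eq_withDensity_seqLR (hσ : ∀ j, 0 < σ j) (θ : Fin N → ℝ) :
    gaussP N σ θ = (gaussP N σ 0).withDensity fun y => ENNReal.ofReal (seqLR N σ θ y) := by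
  refine Measure.pi_eq (μ := fun j => gaussianReal (θ j) (Real.toNNReal (σ j ^ 2)))
    fun s hs => ?_
  rw [withDensity_apply _ (MeasurableSet.univ_pi hs),
    ← ofReal_integral_eq_lintegral_ofReal (integrable_seqLR θ).integrableOn
      (ae_of_all _ (seqLR_nonneg θ))]
  unfold seqLR gaussP
  rw [Measure.restrict_pi_pi, integral_fintype_prod_eq_prod
    (fun j x => gaussLR (θ j) (σ j ^ 2) x), ENNReal.ofReal_prod_of_nonneg
    fun j _ => integral_nonneg fun x => by exact (Real.exp_pos _).le]
  refine Finset.prod_congr rfl fun j _ => ?_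
  have hj := pow_pos (hσ j) 2
  have h := gaussianReal_eq_withDensity_gaussLR (θ j) (v := Real.toNNReal (σ j ^ 2))
    (by simpa using (hσ j).ne')
  rw [h, withDensity_apply _ (hs j), Real.coe_toNNReal _ hj.le,
    ofReal_integral_eq_lintegral_ofReal]
  · rfl
  · exact (integrable_gaussLR _ _ _).integrableOn
  · exact ae_of_all _ fun x => (Real.exp_pos _).le

lemma gaussP_real_eq_setIntegral (hσ : ∀ j, 0 < σ j) (θ : Fin N → ℝ) {A : Set (Fin N → ℝ)}
    (hA : MeasurableSet A) :
    (gaussP N σ θ).real A = ∫ y in A, seqLR N σ θ y ∂(gaussP N σ 0) := by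
  rw [measureReal_def, gaussP_eq_withDensity_seqLR hσ θ, withDensity_apply _ hA,
    integral_eq_lintegral_of_nonneg_ae (ae_of_all _ (seqLR_nonneg θ))
      (integrable_seqLR θ).integrableOn.aestronglyMeasurable]

/-- A mixture with small chi-square divergence cannot be tested: the change of probability of an
event is at most half the `L¹` norm of `g - 1`, itself bounded through the second moment of `g`. -/
lemma setIntegral_le_of_integral_sq_le {Ω : Type*} [MeasurableSpace Ω] (μ : Measure Ω)
    [IsProbabilityMeasure μ] {g : Ω → ℝ} (hg : Integrable g μ)
    (hg2 : Integrable (fun x => g x ^ 2) μ) (h1 : ∫ x, g x ∂μ = 1) {C t : ℝ} (ht : 0 < t)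
    (h2 : ∫ x, g x ^ 2 ∂μ ≤ C) {A : Set Ω} (hA : MeasurableSet A) :
    ∫ x in A, g x ∂μ ≤ μ.real A + (t * (C - 1) + 1 / t) / 4 := by
  have key : ∀ x, A.indicator g x ≤ A.indicator 1 x +
      (t / 4 * g x ^ 2 + (1 / 2 - t / 2) * g x + (t / 4 + 1 / (4 * t) - 1 / 2)) := by
    intro x
    have e1 : 0 ≤ (t * (g x - 1) - 1) ^ 2 / (4 * t) := by positivity
    have e2 : 0 ≤ (t * (g x - 1) + 1) ^ 2 / (4 * t) := by positivity
    have f1 : (t * (g x - 1) - 1) ^ 2 / (4 * t) =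
      t / 4 * (g x - 1) ^ 2 - (g x - 1) / 2 + 1 / (4 * t) := by field_simp; ring
    have f2 : (t * (g x - 1) + 1) ^ 2 / (4 * t) =
      t / 4 * (g x - 1) ^ 2 + (g x - 1) / 2 + 1 / (4 * t) := by field_simp; ring
    by_cases hx : x ∈ A
    · simp only [Set.indicator_of_mem hx, Pi.one_apply]
      linarith
    · simp only [Set.indicator_of_notMem hx]
      linarith
  have hi1 : Integrable (A.indicator (1 : Ω → ℝ)) μ := (integrable_const 1).indicator hA
  have hi2 : Integrable (fun x => t / 4 * g x ^ 2 + (1 / 2 - t / 2) * g x) μ :=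
    (hg2.const_mul _).add (hg.const_mul _)
  have hi3 : Integrable (fun x => t / 4 * g x ^ 2 + (1 / 2 - t / 2) * g x +
      (t / 4 + 1 / (4 * t) - 1 / 2)) μ := hi2.add (integrable_const _)
  have := integral_mono (hg.indicator hA) (hi1.add hi3) key
  rw [integral_indicator hA] at this
  simp only [Pi.add_apply] at this
  rw [integral_add hi1 hi3, integral_indicator_one hA, integral_add hi2 (integrable_const _),
    integral_add (hg2.const_mul _) (hg.const_mul _), integral_const_mul, integral_const_mul, h1,
    integral_const] at this
  simp only [probReal_univ, one_smul] at this
  have h3 : t / 4 * ∫ x, g x ^ 2 ∂μ ≤ t / 4 * C := by gcongr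
  have h4 : (t * (C - 1) + 1 / t) / 4 = t / 4 * C - t / 4 + 1 / (4 * t) := by field_simp
  linarith

lemma exp_half_le : Real.exp (1 / 2) ≤ 1.65 := by
  have h1 := Real.exp_one_lt_d9
  have h2 : Real.exp 1 = Real.exp (1 / 2) ^ 2 := by rw [← Real.exp_nat_mul]; norm_num
  have := Real.exp_pos (1 / 2)
  norm_num at *
  nlinarith

/-- Second moment method for a uniform prior on a finite family of signals. -/
lemma exists_power_le_of_second_moment (hσ : ∀ j, 0 < σ j) {α β : ℝ}
    (hαβ : α + β ≤ 0.59) (hα : 0 ≤ α) {ι : Type*} {s : Finset ι} (hs : s.Nonempty)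
    (θ : ι → Fin N → ℝ)
    (h : ∑ a ∈ s, ∑ b ∈ s, Real.exp (∑ j, θ a j * θ b j / σ j ^ 2) ≤
      Real.exp (1 / 2) * (#s : ℝ) ^ 2)
    {Φ : (Fin N → ℝ) → Bool} (hΦ : IsLevelTest N σ α Φ) :
    ∃ a ∈ s, gaussP N σ (θ a) {y | Φ y = true} ≤ ENNReal.ofReal (1 - β) := by
  have hA : MeasurableSet {y | Φ y = true} := hΦ.1 (measurableSet_singleton true)
  set A := {y | Φ y = true}
  have hc : (0 : ℝ) < #s := by exact_mod_cast hs.card_pos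
  let g : (Fin N → ℝ) → ℝ := fun y => (∑ a ∈ s, seqLR N σ (θ a) y) / #s
  have hg : Integrable g (gaussP N σ 0) :=
    (integrable_finsetSum _ fun a _ => integrable_seqLR (θ a)).div_const _
  have hsq : ∀ y, g y ^ 2 = (∑ a ∈ s, ∑ b ∈ s,
      Real.exp (∑ j, θ a j * θ b j / σ j ^ 2) * seqLR N σ (θ a + θ b) y) / (#s : ℝ) ^ 2 := by
    intro y
    simp only [g]
    rw [div_pow, sq (∑ a ∈ s, _), Finset.sum_mul_sum]
    simp_rw [seqLR_mul hσ]
  have hint : ∀ a b, Integrable (fun y => Real.exp (∑ j, θ a j * θ b j / σ j ^ 2) *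
      seqLR N σ (θ a + θ b) y) (gaussP N σ 0) := fun a b => (integrable_seqLR _).const_mul _
  have hg2 : Integrable (fun y => g y ^ 2) (gaussP N σ 0) := by
    simp_rw [hsq]
    exact (integrable_finsetSum _ fun a _ => integrable_finsetSum _ fun b _ =>
      hint a b).div_const _
  have h1 : ∫ y, g y ∂(gaussP N σ 0) = 1 := by
    simp only [g]
    rw [integral_div, integral_finsetSum _ fun a _ => integrable_seqLR (θ a)]
    simp [integral_seqLR hσ, hc.ne']
  have h2 : ∫ y, g y ^ 2 ∂(gaussP N σ 0) ≤ 1.65 := by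
    simp_rw [hsq]
    rw [integral_div, integral_finsetSum _ fun a _ => integrable_finsetSum _ fun b _ =>
      hint a b]
    simp_rw [integral_finsetSum s fun b _ => hint _ b, integral_const_mul, integral_seqLR hσ,
      mul_one]
    exact (div_le_of_le_mul₀ (by positivity) (by positivity) h).trans exp_half_le
  have h3 := setIntegral_le_of_integral_sq_le _ hg hg2 h1 (t := 1.24) (by norm_num) h2 hA
  have h4 : ∫ y in A, g y ∂(gaussP N σ 0) = (∑ a ∈ s, (gaussP N σ (θ a)).real A) / #s := by
    simp only [g]
    rw [integral_div, integral_finsetSum _ fun a _ => (integrable_seqLR (θ a)).integrableOn]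
    simp_rw [gaussP_real_eq_setIntegral hσ _ hA]
  have h5 : (gaussP N σ 0).real A ≤ α := ENNReal.toReal_le_of_le_ofReal hα hΦ.2
  have h6 : ∑ a ∈ s, (gaussP N σ (θ a)).real A ≤ ∑ a ∈ s, (1 - β) := by
    rw [h4, div_le_iff₀ hc] at h3
    rw [Finset.sum_const, nsmul_eq_mul, mul_comm]
    exact h3.trans (by gcongr; norm_num at *; linarith)
  obtain ⟨a, ha, hle⟩ := Finset.exists_le_of_sum_le hs h6
  refine ⟨a, ha, ?_⟩
  rw [← ofReal_measureReal]
  exact ENNReal.ofReal_le_ofReal hle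

/-- The signal supported by `m` with absolute values `a` and signs `ξ`. -/
def signedSignal (a : Fin N → ℝ) (m : Finset (Fin N)) (ξ : Fin N → Bool) (j : Fin N) : ℝ :=
  if j ∈ m then (if ξ j then a j else -a j) else 0

lemma sum_exp_signedSignal (a : Fin N → ℝ) (m m' : Finset (Fin N)) (ξ : Fin N → Bool) :
    ∑ ξ' : Fin N → Bool,
      Real.exp (∑ j, signedSignal a m ξ j * signedSignal a m' ξ' j / σ j ^ 2) =
      2 ^ N * ∏ j ∈ m ∩ m', Real.cosh (a j ^ 2 / σ j ^ 2) := by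
  let f : Fin N → Bool → ℝ := fun j b => Real.exp (signedSignal a m ξ j *
    (if j ∈ m' then (if b then a j else -a j) else 0) / σ j ^ 2)
  have h1 : ∀ j, ∑ b, f j b = 2 * (if j ∈ m ∩ m' then Real.cosh (a j ^ 2 / σ j ^ 2) else 1) := by
    intro j
    rw [Fintype.sum_bool]
    by_cases hm : j ∈ m <;> by_cases hm' : j ∈ m' <;> rcases hb : ξ j <;>
      simp [f, signedSignal, hm, hm', hb, Real.cosh_eq, neg_div, sq] <;> ring
  calc _ = ∑ ξ' : Fin N → Bool, ∏ j, f j (ξ' j) := by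
        refine Finset.sum_congr rfl fun ξ' _ => ?_
        rw [Real.exp_sum]
        rfl
    _ = ∏ j, ∑ b, f j b := (Fintype.prod_sum f).symm
    _ = _ := by
        simp_rw [h1, Finset.prod_mul_distrib]
        rw [Finset.prod_const, Finset.card_univ, Fintype.card_fin, Finset.prod_ite_mem,
          Finset.univ_inter]

/-- Second moment method for signals with uniform signs and uniform support in a family `S`. -/
lemma exists_signedSignal_power_le (hσ : ∀ j, 0 < σ j) {α β : ℝ}
    (hαβ : α + β ≤ 0.59) (hα : 0 ≤ α) {S : Finset (Finset (Fin N))} (hS : S.Nonempty)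
    (a : Fin N → ℝ)
    (h : ∑ m ∈ S, ∑ m' ∈ S, ∏ j ∈ m ∩ m', Real.cosh (a j ^ 2 / σ j ^ 2) ≤
      Real.exp (1 / 2) * (#S : ℝ) ^ 2)
    {Φ : (Fin N → ℝ) → Bool} (hΦ : IsLevelTest N σ α Φ) :
    ∃ m ∈ S, ∃ ξ, gaussP N σ (signedSignal a m ξ) {y | Φ y = true} ≤ ENNReal.ofReal (1 - β) := by
  obtain ⟨⟨m, ξ⟩, hm, hle⟩ := exists_power_le_of_second_moment hσ hαβ hα
    (s := S ×ˢ (Finset.univ : Finset (Fin N → Bool))) (hS.product Finset.univ_nonempty)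
    (fun p => signedSignal a p.1 p.2) (by
      simp_rw [Finset.sum_product, sum_exp_signedSignal]
      simp only [Finset.sum_const, Finset.card_univ, Fintype.card_pi, Fintype.card_bool,
        Finset.prod_const, Fintype.card_fin, nsmul_eq_mul, ← Finset.mul_sum, Finset.card_product]
      push_cast
      calc _ ≤ (2 : ℝ) ^ N * (2 ^ N * (Real.exp (1 / 2) * (#S : ℝ) ^ 2)) := by gcongr
        _ = _ := by ring) hΦ
  exact ⟨m, (Finset.mem_product.mp hm).1, ξ, hle⟩

lemma sum_sq_signedSignal (a : Fin N → ℝ) (m : Finset (Fin N)) (ξ : Fin N → Bool) :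
    ∑ j, signedSignal a m ξ j ^ 2 = ∑ j ∈ m, a j ^ 2 := by
  have : ∀ j, signedSignal a m ξ j ^ 2 = if j ∈ m then a j ^ 2 else 0 := by
    intro j
    unfold signedSignal
    split_ifs <;> simp
  simp_rw [this]
  simp

lemma signedSignal_mem_Skn {n k : ℕ} (a : Fin N → ℝ) {m : Finset (Fin N)} (ξ : Fin N → Bool)
    (hm : ∀ j ∈ m, (j : ℕ) < n) (hk : #m ≤ k) : signedSignal a m ξ ∈ Skn N n k := by
  refine ⟨fun j hj => if_neg fun h => (hm j h).not_ge hj, ?_⟩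
  refine (Set.ncard_le_ncard (t := (m : Set (Fin N))) fun j hj => ?_).trans ?_
  · by_contra h
    exact hj (if_neg h)
  · rwa [Set.ncard_coe_finset]

lemma choose_sub_mul_pow_le {d k i : ℕ} (hik : i ≤ k) (hkd : k ≤ d) :
    (d - i).choose (k - i) * d ^ i ≤ d.choose k * k ^ i := by
  induction i with
  | zero => simp
  | succ i ih =>
    have ih := ih (by omega)
    obtain ⟨p, rfl⟩ : ∃ p, k = i + 1 + p := ⟨k - (i + 1), by omega⟩
    obtain ⟨q, rfl⟩ : ∃ q, d = i + 1 + p + q := ⟨d - (i + 1 + p), by omega⟩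
    have e1 : i + 1 + p + q - i = p + q + 1 := by omega
    have e2 : i + 1 + p - i = p + 1 := by omega
    have e3 : i + 1 + p + q - (i + 1) = p + q := by omega
    have e4 : i + 1 + p - (i + 1) = p := by omega
    rw [e1, e2] at ih
    rw [e3, e4]
    have hc := Nat.add_one_mul_choose_eq (p + q) p
    refine le_of_mul_le_mul_left (a := p + q + 1) ?_ (Nat.succ_pos _)
    calc (p + q + 1) * ((p + q).choose p * (i + 1 + p + q) ^ (i + 1))
        = ((p + q + 1).choose (p + 1) * (i + 1 + p + q) ^ i) *
          ((p + 1) * (i + 1 + p + q)) := by rw [← mul_assoc, hc]; ring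
      _ ≤ ((i + 1 + p + q).choose (i + 1 + p) * (i + 1 + p) ^ i) *
          ((p + q + 1) * (i + 1 + p)) := by
            refine Nat.mul_le_mul ih ?_
            nlinarith [Nat.zero_le (q * i)]
      _ = _ := by ring

/-- The exponential moment of a hypergeometric variable is at most that of a binomial one. -/
lemma sum_powersetCard_pow_card_inter_le {ι : Type*} [DecidableEq ι] (T : Finset ι) {k : ℕ}
    (hkd : k ≤ #T) {x : ℝ} (hx : 0 ≤ x) {m' : Finset ι}
    (hm' : m' ∈ T.powersetCard k) :
    ∑ m ∈ T.powersetCard k, (1 + x) ^ #(m ∩ m') ≤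
      #(T.powersetCard k) * (1 + (k : ℝ) / #T * x) ^ k := by
  obtain ⟨hmT, hmk⟩ := Finset.mem_powersetCard.mp hm'
  have expand : ∀ (s : Finset ι) (z : ℝ), (1 + z) ^ #s = ∑ A ∈ s.powerset, z ^ #A := by
    intro s z
    rw [← Finset.prod_const, Finset.prod_one_add]
    simp
  have h1 : ∀ m, (1 + x) ^ #(m ∩ m') =
      ∑ A ∈ m'.powerset, if A ⊆ m then x ^ #A else 0 := by
    intro m
    rw [expand, ← Finset.sum_filter]
    refine Finset.sum_congr ?_ fun _ _ => rfl
    ext A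
    simp only [Finset.mem_powerset, Finset.mem_filter, Finset.subset_inter_iff]
    tauto
  simp_rw [h1]
  rw [Finset.sum_comm]
  conv_rhs => rw [← hmk, expand, Finset.mul_sum, hmk]
  refine Finset.sum_le_sum fun A hA => ?_
  have hAm := Finset.mem_powerset.mp hA
  have hAk : #A ≤ k := hmk ▸ Finset.card_le_card hAm
  rw [← Finset.sum_filter, Finset.sum_const, nsmul_eq_mul, mul_pow, div_pow, ← mul_assoc]
  refine mul_le_mul_of_nonneg_right ?_ (by positivity)
  rw [Finset.card_filter_powersetCard_subset _ _ _ (hAm.trans hmT) hAk, Finset.card_powersetCard, ← mul_div_assoc]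
  rcases Nat.eq_zero_or_pos #T with h0 | hpos
  · have : #A = 0 := by omega
    simp [this]
  rw [le_div_iff₀ (by positivity)]
  exact_mod_cast choose_sub_mul_pow_le hAk hkd

lemma mul_cosh_log_sub_one_le {u : ℝ} (hu : 0 < u) :
    1 / u * (Real.cosh (Real.log (1 + max u (Real.sqrt u))) - 1) ≤ 1 / 2 := by
  have hv : 0 < max u (Real.sqrt u) := lt_max_of_lt_left hu
  have hle : max u (Real.sqrt u) ^ 2 ≤ u * (1 + max u (Real.sqrt u)) := by
    rcases max_cases u (Real.sqrt u) with ⟨h, _⟩ | ⟨h, _⟩ <;> rw [h]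
    · nlinarith
    · rw [Real.sq_sqrt hu.le]
      nlinarith [Real.sqrt_nonneg u]
  generalize max u (Real.sqrt u) = v at *
  rw [Real.cosh_log (by positivity)]
  have : (1 + v + (1 + v)⁻¹) / 2 - 1 = v ^ 2 / (2 * (1 + v)) := by
    field_simp
    ring
  rw [this, div_mul_div_comm, div_le_div_iff₀ (by positivity) (by positivity)]
  linarith

/-- Among the `k`-subsets of `[l, n)`, the initial segment minimises the sum of a function which
is non-decreasing on `[0, n)`. -/
lemma sum_Ico_le_sum_of_card_eq {f : ℕ → ℝ} {l n : ℕ}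
    (hf : ∀ i j : ℕ, i ≤ j → j < n → f i ≤ f j) {k : ℕ} {s : Finset ℕ}
    (hs : s ⊆ Finset.Ico l n) (hk : #s = k) :
    ∑ j ∈ Finset.Ico l (l + k), f j ≤ ∑ j ∈ s, f j := by
  induction k generalizing s with
  | zero => simp [Finset.card_eq_zero.mp hk]
  | succ k ih =>
    have hne : s.Nonempty := Finset.card_pos.mp (by omega)
    have hM := s.max'_mem hne
    have hMn := Finset.mem_Ico.mp (hs hM)
    have hsub : s ⊆ Finset.Ico l (s.max' hne + 1) := fun j hj =>
      Finset.mem_Ico.mpr ⟨(Finset.mem_Ico.mp (hs hj)).1, Nat.lt_succ_of_le (s.le_max' j hj)⟩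
    have hc := Finset.card_le_card hsub
    rw [Nat.card_Ico] at hc
    rw [← add_assoc, Finset.sum_Ico_succ_top (by omega), ← Finset.sum_erase_add s f hM]
    exact add_le_add (ih ((Finset.erase_subset _ _).trans hs)
      (by rw [Finset.card_erase_of_mem hM]; omega)) (hf _ _ (by omega) hMn.2)

lemma exists_sparse_power_le (hσ : ∀ j, 0 < σ j) {α β : ℝ} (hαβ : α + β ≤ 0.59) (hα : 0 ≤ α)
    {n k l : ℕ} (hk : 1 ≤ k) (hlk : l + k ≤ n) {σs : ℕ → ℝ} {q : ℕ → Fin N}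
    (hqinj : Set.InjOn q (Set.Iio n)) (hqn : ∀ i, i < n → (q i : ℕ) < n)
    (hqσ : ∀ i, i < n → σs i = σ (q i)) (hsmono : ∀ i j : ℕ, i ≤ j → j < n → σs i ≤ σs j)
    {Φ : (Fin N → ℝ) → Bool} (hΦ : IsLevelTest N σ α Φ) :
    ∃ θ ∈ Skn N n k, SigmaSq σs l k * Real.log (1 + max (((n : ℝ) - l) / (k : ℝ) ^ 2)
        (Real.sqrt (((n : ℝ) - l) / (k : ℝ) ^ 2))) ≤ ∑ j, θ j ^ 2 ∧
      gaussP N σ θ {y | Φ y = true} ≤ ENNReal.ofReal (1 - β) := by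
  have hd : (0 : ℝ) < (n : ℝ) - l := by
    have : l < n := by omega
    rw [sub_pos]
    exact_mod_cast this
  have hk0 : (0 : ℝ) < k := by exact_mod_cast hk
  have hcosh := mul_cosh_log_sub_one_le (u := ((n : ℝ) - l) / (k : ℝ) ^ 2) (by positivity)
  have hx : 0 ≤ Real.log (1 + max (((n : ℝ) - l) / (k : ℝ) ^ 2)
      (Real.sqrt (((n : ℝ) - l) / (k : ℝ) ^ 2))) :=
    Real.log_nonneg (le_add_of_nonneg_right (le_max_of_le_right (Real.sqrt_nonneg _)))
  generalize Real.log (1 + max (((n : ℝ) - l) / (k : ℝ) ^ 2)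
    (Real.sqrt (((n : ℝ) - l) / (k : ℝ) ^ 2))) = x at *
  set T : Finset (Fin N) := (Finset.Ico l n).image q with hT
  have hinj : Set.InjOn q (Finset.Ico l n : Finset ℕ) :=
    hqinj.mono fun i hi => (Finset.mem_Ico.mp hi).2
  have hTc : #T = n - l := by rw [hT, Finset.card_image_of_injOn hinj, Nat.card_Ico]
  have hTr : (#T : ℝ) = (n : ℝ) - l := by rw [hTc, Nat.cast_sub (by omega)]
  have hkT : k ≤ #T := by omega
  let a : Fin N → ℝ := fun j => Real.sqrt x * σ j
  have ha2 : ∀ j, a j ^ 2 = x * σ j ^ 2 := fun j => by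
    simp only [a]
    rw [mul_pow, Real.sq_sqrt hx]
  have ha : ∀ j, a j ^ 2 / σ j ^ 2 = x := fun j => by
    rw [ha2, mul_div_assoc, div_self (pow_pos (hσ j) 2).ne', mul_one]
  obtain ⟨m, hm, ξ, hle⟩ := exists_signedSignal_power_le hσ hαβ hα (S := T.powersetCard k)
    (Finset.powersetCard_nonempty.mpr hkT) a (by
      simp_rw [ha, Finset.prod_const]
      have hpow : (1 + (k : ℝ) / #T * (Real.cosh x - 1)) ^ k ≤ Real.exp (1 / 2) := by
        have h1 := Real.one_le_cosh x
        have h2 : (1 + (k : ℝ) / #T * (Real.cosh x - 1)) ≤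
            Real.exp ((k : ℝ) / #T * (Real.cosh x - 1)) := by
          rw [add_comm]
          exact Real.add_one_le_exp _
        have h3 : 0 ≤ 1 + (k : ℝ) / #T * (Real.cosh x - 1) := by
          have : 0 ≤ (k : ℝ) / #T * (Real.cosh x - 1) := mul_nonneg (by positivity) (by linarith)
          linarith
        refine (pow_le_pow_left₀ h3 h2 k).trans ?_
        rw [← Real.exp_nat_mul, Real.exp_le_exp, hTr]
        refine le_trans (le_of_eq ?_) hcosh
        field_simp
      calc _ ≤ ∑ m ∈ T.powersetCard k, #(T.powersetCard k) *
            (1 + (k : ℝ) / #T * (Real.cosh x - 1)) ^ k := by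
            refine Finset.sum_le_sum fun m hm => ?_
            have h := sum_powersetCard_pow_card_inter_le T hkT
              (sub_nonneg.mpr (Real.one_le_cosh x)) hm
            simp_rw [add_sub_cancel, Finset.inter_comm _ m] at h
            exact h
        _ ≤ ∑ m ∈ T.powersetCard k, #(T.powersetCard k) * Real.exp (1 / 2) := by gcongr
        _ = _ := by
            rw [Finset.sum_const, nsmul_eq_mul]
            ring) hΦ
  obtain ⟨hmT, hmk⟩ := Finset.mem_powersetCard.mp hm
  obtain ⟨s, hs, rfl⟩ := Finset.subset_image_iff.mp hmT
  have hs' : s ⊆ Finset.Ico l n := by exact_mod_cast hs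
  have hsinj : Set.InjOn q s := hinj.mono hs
  rw [Finset.card_image_of_injOn hsinj] at hmk
  refine ⟨_, signedSignal_mem_Skn a ξ ?_ ?_, ?_, hle⟩
  · intro j hj
    obtain ⟨i, hi, rfl⟩ := Finset.mem_image.mp hj
    exact hqn i (Finset.mem_Ico.mp (hs' hi)).2
  · rw [Finset.card_image_of_injOn hsinj, hmk]
  · rw [sum_sq_signedSignal, Finset.sum_image hsinj]
    simp_rw [ha2]
    rw [← Finset.mul_sum, mul_comm]
    refine mul_le_mul_of_nonneg_left ?_ hx
    have hmono : ∀ i j : ℕ, i ≤ j → j < n → σs i ^ 2 ≤ σs j ^ 2 := fun i j hij hj =>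
      pow_le_pow_left₀ (by rw [hqσ i (by omega)]; exact (hσ _).le) (hsmono i j hij hj) 2
    refine (sum_Ico_le_sum_of_card_eq hmono hs' hmk).trans (le_of_eq ?_)
    exact Finset.sum_congr rfl fun i hi => by rw [hqσ i (Finset.mem_Ico.mp (hs' hi)).2]

lemma exists_dense_power_le (hσ : ∀ j, 0 < σ j) {α β : ℝ} (hαβ : α + β ≤ 0.59) (hα : 0 ≤ α)
    {n k : ℕ} (hk : 1 ≤ k) (hkn : k ≤ n) {σs : ℕ → ℝ} {q : ℕ → Fin N}
    (hqinj : Set.InjOn q (Set.Iio n)) (hqn : ∀ i, i < n → (q i : ℕ) < n)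
    (hqσ : ∀ i, i < n → σs i = σ (q i))
    {Φ : (Fin N → ℝ) → Bool} (hΦ : IsLevelTest N σ α Φ) :
    ∃ θ ∈ Skn N n k, Real.sqrt (∑ j ∈ Finset.Ico (n - k) n, σs j ^ 4) ≤ ∑ j, θ j ^ 2 ∧
      gaussP N σ θ {y | Φ y = true} ≤ ENNReal.ofReal (1 - β) := by
  set T : Finset (Fin N) := (Finset.Ico (n - k) n).image q with hT
  have hinj : Set.InjOn q (Finset.Ico (n - k) n : Finset ℕ) :=
    hqinj.mono fun i hi => (Finset.mem_Ico.mp hi).2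
  have hTc : #T = k := by rw [hT, Finset.card_image_of_injOn hinj, Nat.card_Ico]; omega
  have hsum : ∑ j ∈ Finset.Ico (n - k) n, σs j ^ 4 = ∑ j ∈ T, σ j ^ 4 := by
    rw [hT, Finset.sum_image hinj]
    exact Finset.sum_congr rfl fun i hi => by rw [hqσ i (Finset.mem_Ico.mp hi).2]
  rw [hsum]
  have hpos : 0 < ∑ j ∈ T, σ j ^ 4 :=
    Finset.sum_pos (fun j _ => pow_pos (hσ j) 4) (Finset.card_pos.mp (by omega))
  have hR := Real.sqrt_pos.mpr hpos
  have hR2 := Real.sq_sqrt hpos.le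
  set R := Real.sqrt (∑ j ∈ T, σ j ^ 4)
  let a : Fin N → ℝ := fun j => σ j ^ 2 / Real.sqrt R
  have ha2 : ∀ j, a j ^ 2 = σ j ^ 4 / R := fun j => by
    simp only [a]
    rw [div_pow, Real.sq_sqrt hR.le]
    ring
  have ha : ∀ j, a j ^ 2 / σ j ^ 2 = σ j ^ 2 / R := fun j => by
    rw [ha2]
    have := (hσ j).ne'
    field_simp
  obtain ⟨m, hm, ξ, hle⟩ := exists_signedSignal_power_le hσ hαβ hα (S := {T})
    (Finset.singleton_nonempty T) a (by
      simp_rw [ha]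
      simp only [Finset.sum_singleton, Finset.inter_self, Finset.card_singleton, Nat.cast_one,
        one_pow, mul_one]
      calc _ ≤ ∏ j ∈ T, Real.exp ((σ j ^ 2 / R) ^ 2 / 2) :=
            Finset.prod_le_prod (fun j _ => (Real.cosh_pos _).le)
              fun j _ => Real.cosh_le_exp_half_sq _
        _ = Real.exp (∑ j ∈ T, σ j ^ 4 / (2 * R ^ 2)) := by
            rw [Real.exp_sum]
            refine Finset.prod_congr rfl fun j _ => ?_
            congr 1
            field_simp
        _ = Real.exp (1 / 2) := by
            rw [← Finset.sum_div, ← hR2]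
            congr 1
            field_simp) hΦ
  rw [Finset.mem_singleton.mp hm] at hle
  refine ⟨_, signedSignal_mem_Skn a ξ ?_ hTc.le, ?_, hle⟩
  · intro j hj
    obtain ⟨i, hi, rfl⟩ := Finset.mem_image.mp hj
    exact hqn i (Finset.mem_Ico.mp hi).2
  · rw [sum_sq_signedSignal]
    simp_rw [ha2]
    rw [← Finset.sum_div, ← hR2, sq, mul_div_assoc, div_self hR.ne', mul_one]

end LowerBound

/-- Theorem 1: lower bound for the minimax rate of sparse signal detection in the `l₂` norm. -/
theorem stmt1 (N n k : ℕ) (hk : 1 ≤ k) (hkn : k ≤ n) (hnN : n ≤ N)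
    (σ : Fin N → ℝ) (hσ : ∀ j, 0 < σ j)
    (σs : ℕ → ℝ)
    (hperm : ∃ e : Equiv.Perm (Fin n), ∀ j : Fin n, σs (j : ℕ) = σ (Fin.castLE hnN (e j)))
    (hsmono : ∀ i j : ℕ, i ≤ j → j < n → σs i ≤ σs j)
    (α β : ℝ) (hα0 : 0 < α) (hα1 : α < 1) (hβ0 : 0 < β) (hβ1 : β < 1 - α)
    (hαβ : α + β ≤ 0.59)
    (ρkn : ℝ) (hρkn0 : 0 ≤ ρkn)
    (hρkn : ρkn ^ 2 =
      max
        ((Finset.range (n - k + 1)).sup' ⟨0, Finset.mem_range.mpr (Nat.succ_pos _)⟩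
          fun l => SigmaSq σs l k *
            Real.log (1 + max (((n : ℝ) - l) / (k : ℝ) ^ 2)
              (Real.sqrt (((n : ℝ) - l) / (k : ℝ) ^ 2))))
        (Real.sqrt (∑ j ∈ Finset.Ico (n - k) n, σs j ^ 4))) :
    (∀ Φ : (Fin N → ℝ) → Bool, IsLevelTest N σ α Φ →
      (⨅ θ : {θ : Fin N → ℝ // θ ∈ Skn N n k ∧ ρkn ≤ l2norm N θ},
        gaussP N σ θ.1 {y | Φ y = true}) ≤ ENNReal.ofReal (1 - β)) ∧
    ENNReal.ofReal ρkn ≤ minimaxRate N σ (Skn N n k) α β := by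
  classical
  have hex : ∀ Φ : (Fin N → ℝ) → Bool, IsLevelTest N σ α Φ →
      ∃ θ ∈ Skn N n k, ρkn ≤ l2norm N θ ∧
        gaussP N σ θ {y | Φ y = true} ≤ ENNReal.ofReal (1 - β) := by
    intro Φ hΦ
    obtain ⟨e, he⟩ := hperm
    let q : ℕ → Fin N := fun i =>
      if h : i < n then Fin.castLE hnN (e ⟨i, h⟩) else ⟨0, by omega⟩
    have hq : ∀ i (h : i < n), q i = Fin.castLE hnN (e ⟨i, h⟩) := fun i h => dif_pos h
    have hqinj : Set.InjOn q (Set.Iio n) := by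
      intro i hi j hj hij
      rw [hq i hi, hq j hj] at hij
      exact congrArg Fin.val (e.injective (Fin.castLE_injective hnN hij))
    have hqn : ∀ i, i < n → (q i : ℕ) < n := fun i h => by
      rw [hq i h]
      exact (e ⟨i, h⟩).2
    have hqσ : ∀ i, i < n → σs i = σ (q i) := fun i h => by
      rw [hq i h]
      exact he ⟨i, h⟩
    suffices h : ∃ θ ∈ Skn N n k, ρkn ^ 2 ≤ ∑ j, θ j ^ 2 ∧
        gaussP N σ θ {y | Φ y = true} ≤ ENNReal.ofReal (1 - β) by
      obtain ⟨θ, hθ, hle, hp⟩ := h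
      exact ⟨θ, hθ, Real.le_sqrt_of_sq_le hle, hp⟩
    rw [hρkn]
    rcases max_choice ((Finset.range (n - k + 1)).sup' ⟨0, Finset.mem_range.mpr (Nat.succ_pos _)⟩
        fun l => SigmaSq σs l k *
          Real.log (1 + max (((n : ℝ) - l) / (k : ℝ) ^ 2)
            (Real.sqrt (((n : ℝ) - l) / (k : ℝ) ^ 2))))
        (Real.sqrt (∑ j ∈ Finset.Ico (n - k) n, σs j ^ 4)) with h | h <;> rw [h]
    · obtain ⟨l, hl, hsup⟩ := Finset.exists_mem_eq_sup' (s := Finset.range (n - k + 1))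
        ⟨0, Finset.mem_range.mpr (Nat.succ_pos _)⟩ fun l : ℕ => SigmaSq σs l k *
          Real.log (1 + max (((n : ℝ) - l) / (k : ℝ) ^ 2)
            (Real.sqrt (((n : ℝ) - l) / (k : ℝ) ^ 2)))
      rw [hsup]
      have hl' := Finset.mem_range.mp hl
      exact exists_sparse_power_le hσ hαβ hα0.le hk (by omega) hqinj hqn hqσ hsmono hΦ
    · exact exists_dense_power_le hσ hαβ hα0.le hk hkn hqinj hqn hqσ hΦ
  refine ⟨fun Φ hΦ => ?_, ?_⟩
  · obtain ⟨θ, hθ, hρ, hp⟩ := hex Φ hΦ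
    exact iInf_le_of_le ⟨θ, hθ, hρ⟩ hp
  · refine le_sInf ?_
    rintro r ⟨Φ, hΦ, rfl⟩
    refine le_sInf fun ρ hρ => ?_
    obtain ⟨θ, hθ, hle, hp⟩ := hex Φ hΦ
    by_contra! hlt
    exact (hρ.2 θ hθ (hlt.le.trans (ENNReal.ofReal_le_ofReal hle))).not_ge hp
end
end

section
/- Let α, β ∈ (0,1), let t_{D,1−α}(σ) be the 1−α quantile of Σ_{j=1}^D σ_j² ε_j² (i.e. P(Σ_{j=1}^D σ_j² ε_j² ≥ t_{D,1−α}(σ)) = α), and let Φ_α be the test rejecting when Σ_{j=1}^D Y_j² > t_{D,1−α}(σ). Then Φ_α has exact level α, i.e. P_{θ=0}(Φ_α = 1) = α. Moreover there exists an absolute constant C such that, setting C(α,β) = C(log(β⁻¹) + log(α⁻¹) + √(log(α⁻¹)) + √(log(β⁻¹))), every θ ∈ S_D with ‖θ‖₂² ≥ C(α,β) (Σ_{j=1}^D σ_j⁴)^{1/2} satisfies P_θ(Φ_α = 1) > 1 − β. Consequently ρ₂²(S_D, α, β) ≤ C(α,β) (Σ_{j=1}^D σ_j⁴)^{1/2}.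 -/
open MeasureTheory ProbabilityTheory ENNReal Finset

noncomputable section

/-- The set `S_D` of signals whose coefficients vanish after the (1-indexed) rank `D`. -/
def SD (N D : ℕ) : Set (Fin N → ℝ) := {θ | ∀ j : Fin N, D ≤ (j : ℕ) → θ j = 0}

section Laplace

/-- Tilting a Gaussian density by `exp (-l y²)` yields a multiple of a Gaussian density. -/
lemma gaussianPDFReal_mul_exp_neg_sq (m l : ℝ) {v : NNReal} (hv : v ≠ 0)
    (h : 0 < 1 + 2 * l * v) (y : ℝ) :
    gaussianPDFReal m v y * Real.exp (-(l * y ^ 2)) =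
      (√(1 + 2 * l * v))⁻¹ * Real.exp (-(l * m ^ 2 / (1 + 2 * l * v))) *
        gaussianPDFReal (m / (1 + 2 * l * v)) (v / (1 + 2 * l * v).toNNReal) y := by
  have hv' : (0 : ℝ) < v := by positivity
  simp only [gaussianPDFReal, NNReal.coe_div, Real.coe_toNNReal _ h.le]
  set q : ℝ := 1 + 2 * l * v with hq
  have hl : l = (q - 1) / (2 * v) := by rw [hq]; field_simp; ring
  have hs : (√(2 * Real.pi * (v / q)))⁻¹ = (√(2 * Real.pi * v))⁻¹ * √q := by
    rw [← mul_div_assoc, Real.sqrt_div (by positivity), inv_div, div_eq_mul_inv, mul_comm]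
  have hq0 : √q ≠ 0 := (Real.sqrt_pos.2 h).ne'
  rw [hs, mul_assoc, ← Real.exp_add]
  have he : -(y - m) ^ 2 / (2 * (v : ℝ)) + -(l * y ^ 2) =
      -(l * m ^ 2 / q) + -(y - m / q) ^ 2 / (2 * (v / q)) := by
    rw [hl]; field_simp; ring
  rw [he, Real.exp_add]
  field_simp

lemma integrable_exp_neg_sq_gaussianReal (m l : ℝ) {v : NNReal} (hv : v ≠ 0)
    (h : 0 < 1 + 2 * l * v) :
    Integrable (fun y => Real.exp (-(l * y ^ 2))) (gaussianReal m v) := by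
  rw [gaussianReal_of_var_ne_zero _ hv,
    integrable_withDensity_iff_integrable_smul' (measurable_gaussianPDF _ _)
      (ae_of_all _ fun _ => gaussianPDF_lt_top)]
  simp only [toReal_gaussianPDF, smul_eq_mul, gaussianPDFReal_mul_exp_neg_sq m l hv h]
  exact (integrable_gaussianPDFReal _ _).const_mul _

lemma integral_exp_neg_sq_gaussianReal (m l : ℝ) {v : NNReal} (hv : v ≠ 0)
    (h : 0 < 1 + 2 * l * v) :
    ∫ y, Real.exp (-(l * y ^ 2)) ∂(gaussianReal m v) =
      (√(1 + 2 * l * v))⁻¹ * Real.exp (-(l * m ^ 2 / (1 + 2 * l * v))) := by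
  rw [integral_gaussianReal_eq_integral_smul hv]
  simp only [smul_eq_mul, gaussianPDFReal_mul_exp_neg_sq m l hv h]
  rw [integral_const_mul, integral_gaussianPDFReal_eq_one, mul_one]
  exact div_ne_zero hv (by simpa using h)

lemma inv_sqrt_one_add_le_exp {u : ℝ} (hu : |u| ≤ 1 / 2) :
    (√(1 + u))⁻¹ ≤ Real.exp (-(u / 2) + u ^ 2) := by
  obtain ⟨h1, h2⟩ := abs_le.1 hu
  have hp : 0 < 1 + u := by linarith
  have hlog : u - 2 * u ^ 2 ≤ Real.log (1 + u) := by
    refine le_trans ?_ (Real.one_sub_inv_le_log_of_pos hp)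
    have : 1 - (1 + u)⁻¹ - (u - 2 * u ^ 2) = u ^ 2 * (1 + 2 * u) / (1 + u) := by
      field_simp; ring
    have h3 : 0 ≤ u ^ 2 * (1 + 2 * u) / (1 + u) :=
      div_nonneg (mul_nonneg (sq_nonneg _) (by linarith)) hp.le
    linarith
  rw [← Real.log_le_iff_le_exp (by positivity), Real.log_inv, Real.log_sqrt hp.le]
  linarith

/-- Laplace transform bound for the square of a Gaussian variable. -/
lemma integral_exp_neg_sq_gaussianReal_le {m l s : ℝ} (hs : 0 < s)
    (hu : |2 * l * s ^ 2| ≤ 1 / 2) (hl : 0 ≤ l ∨ m = 0) :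
    ∫ y, Real.exp (-(l * y ^ 2)) ∂(gaussianReal m (Real.toNNReal (s ^ 2))) ≤
      Real.exp (-(l * s ^ 2) + 4 * l ^ 2 * s ^ 4 - 2 / 3 * l * m ^ 2) := by
  have hv : Real.toNNReal (s ^ 2) ≠ 0 := by
    simpa using hs.ne'
  have hc : ((Real.toNNReal (s ^ 2) : NNReal) : ℝ) = s ^ 2 := Real.coe_toNNReal _ (sq_nonneg s)
  obtain ⟨h1, h2⟩ := abs_le.1 hu
  rw [integral_exp_neg_sq_gaussianReal m l hv (by rw [hc]; linarith), hc]
  have hm : 2 / 3 * l * m ^ 2 ≤ l * m ^ 2 / (1 + 2 * l * s ^ 2) := by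
    rcases hl with hl | rfl
    · rw [le_div_iff₀ (by linarith)]
      nlinarith [mul_nonneg hl (sq_nonneg m)]
    · simp
  calc _ ≤ Real.exp (-(2 * l * s ^ 2 / 2) + (2 * l * s ^ 2) ^ 2) *
        Real.exp (-(l * m ^ 2 / (1 + 2 * l * s ^ 2))) := by
        gcongr
        exact inv_sqrt_one_add_le_exp hu
    _ ≤ _ := by
        rw [← Real.exp_add, Real.exp_le_exp]
        nlinarith

end Laplace

section Chernoff

instance isProbabilityMeasure_gaussP (N : ℕ) (σ θ : Fin N → ℝ) :
    IsProbabilityMeasure (gaussP N σ θ) := by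
  unfold gaussP; infer_instance

lemma measurable_lowSum_sq (N D : ℕ) :
    Measurable fun y : Fin N → ℝ => lowSum N D fun j => y j ^ 2 := by
  unfold lowSum; fun_prop

lemma sq_le_sqrt_lowSum {N D : ℕ} (σ : Fin N → ℝ) {j : Fin N} (hj : (j : ℕ) < D) :
    σ j ^ 2 ≤ √(lowSum N D fun j => σ j ^ 4) := by
  refine Real.le_sqrt_of_sq_le ?_
  rw [← pow_mul]
  exact single_le_sum (s := univ.filter fun j : Fin N => (j : ℕ) < D) (f := fun j => σ j ^ 4)
    (fun i _ => by positivity) (by simpa using hj)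

/-- Chernoff bound for the quadratic statistic; a negative `l` gives the upper tail. -/
lemma gaussP_real_le_exp {N D : ℕ} {σ θ : Fin N → ℝ} (hσ : ∀ j, 0 < σ j) {l : ℝ} (r : ℝ)
    (hls : |l| * √(lowSum N D fun j => σ j ^ 4) ≤ 1 / 4) (hl : 0 ≤ l ∨ θ = 0) :
    (gaussP N σ θ).real {y | r ≤ -(l * lowSum N D fun j => y j ^ 2)} ≤
      Real.exp (-r - (l * lowSum N D fun j => σ j ^ 2)
        + (4 * l ^ 2 * lowSum N D fun j => σ j ^ 4)
        - 2 / 3 * l * lowSum N D fun j => θ j ^ 2) := by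
  set w : Fin N → ℝ := fun j => if (j : ℕ) < D then l else 0 with hw
  have hsum (c : ℝ → ℝ) (hc : c 0 = 0) (f : Fin N → ℝ) :
      ∑ j, c (w j) * f j = c l * lowSum N D f := by
    unfold lowSum
    rw [mul_sum, sum_filter]
    refine sum_congr rfl fun j _ => ?_
    by_cases hj : (j : ℕ) < D <;> simp [hw, hj, hc]
  have hexp (y : Fin N → ℝ) :
      Real.exp (1 * -(l * lowSum N D fun j => y j ^ 2)) =
        ∏ j, Real.exp (-(w j * y j ^ 2)) := by
    rw [← Real.exp_sum, sum_neg_distrib, hsum (fun x => x) rfl, one_mul]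
  have hu (j : Fin N) : |2 * w j * σ j ^ 2| ≤ 1 / 2 := by
    by_cases hj : (j : ℕ) < D
    · have h := sq_le_sqrt_lowSum (N := N) (D := D) σ hj
      have := (mul_le_mul_of_nonneg_left h (abs_nonneg l)).trans hls
      simp only [hw, hj, if_true]
      rw [abs_mul, abs_mul, abs_two, abs_of_nonneg (sq_nonneg (σ j))]
      linarith
    · simp [hw, hj]
  have hw0 (j : Fin N) : 0 ≤ w j ∨ θ j = 0 := by
    rcases hl with hl | rfl
    · left; simp only [hw]; split_ifs <;> simp [hl]
    · right; rfl
  have hint : Integrable (fun y : Fin N → ℝ => ∏ j, Real.exp (-(w j * y j ^ 2)))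
      (gaussP N σ θ) := by
    refine Integrable.fintype_prod (f := fun j x => Real.exp (-(w j * x ^ 2))) fun j => ?_
    refine integrable_exp_neg_sq_gaussianReal _ _ (by simpa using (hσ j).ne') ?_
    rw [Real.coe_toNNReal _ (sq_nonneg _)]
    linarith [(abs_le.1 (hu j)).1]
  refine (measure_ge_le_exp_mul_mgf r zero_le_one (by simpa only [hexp] using hint)).trans ?_
  simp only [mgf, hexp]
  rw [gaussP, integral_fintype_prod_eq_prod (f := fun j x => Real.exp (-(w j * x ^ 2)))]
  calc _ ≤ Real.exp (-1 * r) * ∏ j, Real.exp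
        (-(w j * σ j ^ 2) + 4 * w j ^ 2 * σ j ^ 4 - 2 / 3 * w j * θ j ^ 2) := by
        gcongr with j
        exact integral_exp_neg_sq_gaussianReal_le (hσ j) (hu j) (hw0 j)
    _ = _ := by
        rw [← Real.exp_sum, ← Real.exp_add, sum_sub_distrib, sum_add_distrib, sum_neg_distrib,
          hsum (fun x => x) rfl, hsum (fun x => 4 * x ^ 2) (by simp),
          hsum (fun x => 2 / 3 * x) (by simp)]
        ring_nf

end Chernoff

section Comparison

/-- A centred interval carries more Gaussian mass when the Gaussian is centred. -/
lemma gaussianReal_sq_le_le (m r : ℝ) {v : NNReal} (hv : v ≠ 0) :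
    gaussianReal m v {x | x ^ 2 ≤ r} ≤ gaussianReal 0 v {x | x ^ 2 ≤ r} := by
  set A : Set ℝ := {x | x ^ 2 ≤ r} with hA
  have hAm : MeasurableSet A := measurableSet_le (by fun_prop) (by fun_prop)
  set B : Set ℝ := (fun x => x + m) ⁻¹' A with hB
  have hBm : MeasurableSet B := (measurable_id.add_const m) hAm
  have hAB : gaussianReal m v A = gaussianReal 0 v B := by
    rw [hB, ← Measure.map_apply (by fun_prop) hAm, gaussianReal_map_add_const, zero_add]
  have hvol : volume B = volume A := measure_preimage_add_right volume m A
  have hfin : volume A ≠ ∞ := by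
    refine ne_top_of_le_ne_top (measure_Icc_lt_top (a := -√r) (b := √r)).ne
      (measure_mono fun x hx => abs_le.1 (Real.abs_le_sqrt hx))
  have hdiff : volume (B \ A) = volume (A \ B) := by
    have h : volume (B ∩ A) + volume (B \ A) = volume (B ∩ A) + volume (A \ B) := by
      rw [measure_inter_add_sdiff B hAm, Set.inter_comm B A, measure_inter_add_sdiff A hBm, hvol]
    exact (ENNReal.add_right_inj
      (ne_top_of_le_ne_top hfin (measure_mono Set.inter_subset_right))).1 h
  set c : ℝ≥0∞ := ENNReal.ofReal ((√(2 * Real.pi * v))⁻¹ * Real.exp (-r / (2 * v)))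
  have hout : gaussianReal 0 v (B \ A) ≤ c * volume (B \ A) := by
    rw [gaussianReal_apply _ hv, ← setLIntegral_const]
    refine setLIntegral_mono' (hBm.diff hAm) fun x hx => ?_
    have hx' : r < x ^ 2 := not_le.1 hx.2
    simp only [gaussianPDF, gaussianPDFReal, sub_zero]
    refine ENNReal.ofReal_le_ofReal ?_
    gcongr
  have hin : c * volume (A \ B) ≤ gaussianReal 0 v (A \ B) := by
    rw [gaussianReal_apply _ hv, ← setLIntegral_const]
    refine setLIntegral_mono' (hAm.diff hBm) fun x hx => ?_
    have hx' : x ^ 2 ≤ r := hx.1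
    simp only [gaussianPDF, gaussianPDFReal, sub_zero]
    refine ENNReal.ofReal_le_ofReal ?_
    gcongr
  rw [hAB, ← measure_inter_add_sdiff B hAm, ← measure_inter_add_sdiff A hBm, Set.inter_comm B A]
  exact add_le_add le_rfl (hout.trans (hdiff ▸ hin))

lemma gaussianReal_mul_sq_le_le (m w r : ℝ) (hw : 0 ≤ w) {v : NNReal} (hv : v ≠ 0) :
    gaussianReal m v {x | w * x ^ 2 ≤ r} ≤ gaussianReal 0 v {x | w * x ^ 2 ≤ r} := by
  rcases hw.eq_or_lt with rfl | hw
  · by_cases hr : 0 ≤ r <;> simp [hr]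
  · simp only [mul_comm w, ← le_div_iff₀ hw]
    exact gaussianReal_sq_le_le m _ hv

lemma gaussP_succ_apply {n : ℕ} (σ θ : Fin (n + 1) → ℝ) {A : Set (ℝ × (Fin n → ℝ))}
    (hA : MeasurableSet A) :
    gaussP (n + 1) σ θ {y | (y 0, fun j : Fin n => y j.succ) ∈ A} =
      ((gaussianReal (θ 0) (Real.toNNReal (σ 0 ^ 2))).prod
        (gaussP n (Fin.tail σ) (Fin.tail θ))) A :=
  (measurePreserving_piFinSuccAbove
    (fun j => gaussianReal (θ j) (Real.toNNReal (σ j ^ 2))) 0).measure_preimage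
      hA.nullMeasurableSet

/-- Weighted sums of squares are stochastically smallest when the Gaussian vector is centred. -/
lemma gaussP_sum_mul_sq_le_le {N : ℕ} {σ w : Fin N → ℝ} (hσ : ∀ j, 0 < σ j)
    (hw : ∀ j, 0 ≤ w j) (θ : Fin N → ℝ) (r : ℝ) :
    gaussP N σ θ {y | ∑ j, w j * y j ^ 2 ≤ r} ≤ gaussP N σ 0 {y | ∑ j, w j * y j ^ 2 ≤ r} := by
  induction N generalizing r with
  | zero =>
    rw [Subsingleton.elim θ 0]
  | succ n ih =>
    set A : Set (ℝ × (Fin n → ℝ)) :=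
      {p | w 0 * p.1 ^ 2 + ∑ j, Fin.tail w j * p.2 j ^ 2 ≤ r} with hA
    have hAm : MeasurableSet A := measurableSet_le (by fun_prop) (by fun_prop)
    have hset : {y : Fin (n + 1) → ℝ | ∑ j, w j * y j ^ 2 ≤ r} =
        {y | (y 0, fun j : Fin n => y j.succ) ∈ A} := by
      ext y
      simp [hA, Fin.sum_univ_succ, Fin.tail]
    rw [hset, gaussP_succ_apply σ θ hAm, gaussP_succ_apply σ 0 hAm]
    calc _ ≤ ((gaussianReal (θ 0) (Real.toNNReal (σ 0 ^ 2))).prod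
          (gaussP n (Fin.tail σ) 0)) A := by
          rw [Measure.prod_apply hAm, Measure.prod_apply hAm]
          refine lintegral_mono fun x => ?_
          have := ih (σ := Fin.tail σ) (w := Fin.tail w) (fun j => hσ _) (fun j => hw _)
            (Fin.tail θ) (r - w 0 * x ^ 2)
          simpa only [hA, Set.preimage_ofPred_eq, le_sub_iff_add_le'] using this
      _ ≤ _ := by
          rw [Measure.prod_apply_symm hAm, Measure.prod_apply_symm hAm]
          refine lintegral_mono fun z => ?_
          have := gaussianReal_mul_sq_le_le (θ 0) (w 0) (r - ∑ j, Fin.tail w j * z j ^ 2) (hw 0)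
            (v := Real.toNNReal (σ 0 ^ 2)) (by simpa using (hσ 0).ne')
          simpa only [hA, Set.preimage_ofPred_eq, le_sub_iff_add_le] using! this

lemma lowSum_eq_sum (N D : ℕ) (f : Fin N → ℝ) :
    lowSum N D f = ∑ j : Fin N, (if (j : ℕ) < D then 1 else 0) * f j := by
  simp [lowSum, sum_filter]

lemma gaussP_lowSum_sq_le_le {N D : ℕ} {σ : Fin N → ℝ} (hσ : ∀ j, 0 < σ j) (θ : Fin N → ℝ)
    (r : ℝ) :
    gaussP N σ θ {y | (lowSum N D fun j => y j ^ 2) ≤ r} ≤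
      gaussP N σ 0 {y | (lowSum N D fun j => y j ^ 2) ≤ r} := by
  simp only [lowSum_eq_sum]
  exact gaussP_sum_mul_sq_le_le hσ (fun j => by split_ifs <;> simp) θ r

/-- The quadratic statistic has no atoms. -/
lemma gaussP_lowSum_sq_eq {N D : ℕ} (hD : 1 ≤ D) (hDN : D ≤ N) {σ : Fin N → ℝ}
    (hσ : ∀ j, 0 < σ j) (θ : Fin N → ℝ) (r : ℝ) :
    gaussP N σ θ {y | (lowSum N D fun j => y j ^ 2) = r} = 0 := by
  obtain ⟨n, rfl⟩ : ∃ n, N = n + 1 := ⟨N - 1, by lia⟩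
  set A : Set (ℝ × (Fin n → ℝ)) :=
    {p | p.1 ^ 2 + ∑ j : Fin n, (if (j : ℕ) + 1 < D then 1 else 0) * p.2 j ^ 2 = r} with hA
  have hAm : MeasurableSet A := measurableSet_eq_fun (by fun_prop) (by fun_prop)
  have hset : {y : Fin (n + 1) → ℝ | (lowSum (n + 1) D fun j => y j ^ 2) = r} =
      {y | (y 0, fun j : Fin n => y j.succ) ∈ A} := by
    ext y
    have : 0 < D := hD
    simp [hA, lowSum_eq_sum, Fin.sum_univ_succ, this]
  rw [hset, gaussP_succ_apply σ θ hAm, Measure.prod_apply_symm hAm]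
  refine lintegral_eq_zero_of_ae_eq_zero (ae_of_all _ fun z => ?_)
  have := nullSingletonClass_gaussianReal (μ := θ 0) (v := Real.toNNReal (σ 0 ^ 2))
    (by simpa using (hσ 0).ne')
  set q := r - ∑ j : Fin n, (if (j : ℕ) + 1 < D then 1 else 0) * z j ^ 2 with hq
  refine measure_mono_null (t := {√q, -√q}) (fun x hx => ?_)
    ((Set.toFinite _).measure_zero _)
  have hx' : x ^ 2 = q := eq_sub_of_add_eq hx
  rw [Set.mem_insert_iff, Set.mem_singleton_iff, ← hx', Real.sqrt_sq_eq_abs]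
  rcases abs_choice x with h | h <;> simp [h]

end Comparison

section Power

lemma gaussP_lt_lowSum_sq {N D : ℕ} (σ θ : Fin N → ℝ) (t : ℝ) :
    gaussP N σ θ {y | t < lowSum N D fun j => y j ^ 2} =
      1 - gaussP N σ θ {y | (lowSum N D fun j => y j ^ 2) ≤ t} := by
  rw [← prob_compl_eq_one_sub (measurableSet_le (measurable_lowSum_sq N D) measurable_const)]
  congr 1
  ext y
  simp

lemma l2norm_sq_eq_lowSum {N D : ℕ} {θ : Fin N → ℝ} (hθ : θ ∈ SD N D) :
    l2norm N θ ^ 2 = lowSum N D fun j => θ j ^ 2 := by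
  rw [l2norm, Real.sq_sqrt (sum_nonneg fun _ _ => sq_nonneg _), lowSum, sum_filter]
  refine sum_congr rfl fun j _ => ?_
  split_ifs with h
  · rfl
  · simp [hθ j (not_lt.1 h)]

lemma lowSum_pow_four_pos {N D : ℕ} (hD : 1 ≤ D) (hDN : D ≤ N) {σ : Fin N → ℝ}
    (hσ : ∀ j, 0 < σ j) : 0 < lowSum N D fun j => σ j ^ 4 :=
  sum_pos (fun j _ => pow_pos (hσ j) 4) ⟨⟨0, by lia⟩, by simpa using Nat.lt_of_lt_of_le zero_lt_one hD⟩

/-- Probability of second kind error of the chi-square test with threshold `t`. -/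
lemma gaussP_real_lowSum_sq_le_exp {N D : ℕ} (hD : 1 ≤ D) (hDN : D ≤ N) {σ : Fin N → ℝ}
    (hσ : ∀ j, 0 < σ j) (θ : Fin N → ℝ) {α t : ℝ} (hα : 0 < α)
    (ht : gaussP N σ 0 {y | t ≤ lowSum N D fun j => y j ^ 2} = ENNReal.ofReal α) :
    (gaussP N σ θ).real {y | (lowSum N D fun j => y j ^ 2) ≤ t} ≤
      Real.exp (Real.log α⁻¹ + 1 / 2 -
        (lowSum N D fun j => θ j ^ 2) / (6 * √(lowSum N D fun j => σ j ^ 4))) := by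
  have hS := lowSum_pow_four_pos hD hDN hσ
  have hs := Real.sqrt_pos.2 hS
  have hss := Real.sq_sqrt hS.le
  set s := √(lowSum N D fun j => σ j ^ 4)
  set l : ℝ := 1 / (4 * s) with hl
  have hl0 : 0 < l := by positivity
  have hls : l * s = 1 / 4 := by rw [hl]; field_simp
  have hup := gaussP_real_le_exp (D := D) (θ := 0) hσ (l := -l) (l * t)
    (by rw [abs_neg, abs_of_pos hl0]; exact hls.le) (Or.inr rfl)
  have hlow := gaussP_real_le_exp (D := D) (θ := θ) hσ (l := l) (-(l * t))
    (by rw [abs_of_pos hl0]; exact hls.le) (Or.inl hl0.le)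
  have hquad : 4 * l ^ 2 * (lowSum N D fun j => σ j ^ 4) = 1 / 4 := by
    rw [← hss]; linear_combination (4 * (l * s) + 1) * hls
  have hzero : (lowSum N D fun j => (0 : Fin N → ℝ) j ^ 2) = 0 := by simp [lowSum]
  rw [neg_sq, hquad, hzero] at hup
  rw [hquad] at hlow
  simp only [neg_mul, neg_neg, neg_le_neg_iff, mul_le_mul_iff_right₀ hl0] at hup hlow
  have hαt : (gaussP N σ 0).real {y | t ≤ lowSum N D fun j => y j ^ 2} = α := by
    rw [measureReal_def, ht, ENNReal.toReal_ofReal hα.le]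
  rw [hαt, ← Real.log_le_iff_le_exp hα] at hup
  refine hlow.trans (Real.exp_le_exp.2 ?_)
  have hT : (lowSum N D fun j => θ j ^ 2) / (6 * s) =
      2 / 3 * l * lowSum N D fun j => θ j ^ 2 := by
    rw [hl]; field_simp; ring
  rw [Real.log_inv, hT]
  linarith

/-- Power of the chi-square test. -/
lemma ofReal_lt_gaussP_lowSum_sq {N D : ℕ} (hD : 1 ≤ D) (hDN : D ≤ N) {σ : Fin N → ℝ}
    (hσ : ∀ j, 0 < σ j) {α β t : ℝ} (hα : 0 < α) (hβ : 0 < β) (hβ1 : β < 1)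
    (ht : gaussP N σ 0 {y | t ≤ lowSum N D fun j => y j ^ 2} = ENNReal.ofReal α)
    (ht' : gaussP N σ 0 {y | t < lowSum N D fun j => y j ^ 2} = ENNReal.ofReal α)
    {θ : Fin N → ℝ}
    (hθ : 12 * (Real.log β⁻¹ + Real.log α⁻¹) * √(lowSum N D fun j => σ j ^ 4) ≤
      lowSum N D fun j => θ j ^ 2) :
    ENNReal.ofReal (1 - β) < gaussP N σ θ {y | t < lowSum N D fun j => y j ^ 2} := by
  rcases lt_or_ge 1 (α + β) with h | h
  · calc ENNReal.ofReal (1 - β) < ENNReal.ofReal α :=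
          (ENNReal.ofReal_lt_ofReal_iff hα).2 (by linarith)
      _ ≤ _ := by
          rw [← ht', gaussP_lt_lowSum_sq, gaussP_lt_lowSum_sq]
          exact tsub_le_tsub_left (gaussP_lowSum_sq_le_le hσ θ t) 1
  have hs := Real.sqrt_pos.2 (lowSum_pow_four_pos hD hDN hσ)
  have hL : 1 / 2 < Real.log β⁻¹ + Real.log α⁻¹ := by
    rw [← Real.log_mul (by positivity) (by positivity), ← mul_inv]
    have h4 : (4 : ℝ) ≤ (β * α)⁻¹ := by
      rw [le_inv_comm₀ (by norm_num) (by positivity)]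
      nlinarith [sq_nonneg (α - β)]
    have h2 : (2 : ℝ) ≤ (β * α)⁻¹ := by linarith
    have := Real.log_le_log (by norm_num) h2
    linarith [Real.log_two_gt_d9]
  have herr := gaussP_real_lowSum_sq_le_exp hD hDN hσ θ hα ht
  have hlt : (gaussP N σ θ).real {y | (lowSum N D fun j => y j ^ 2) ≤ t} < β := by
    refine herr.trans_lt ?_
    rw [← Real.lt_log_iff_exp_lt hβ]
    have : 2 * (Real.log β⁻¹ + Real.log α⁻¹) ≤
        (lowSum N D fun j => θ j ^ 2) / (6 * √(lowSum N D fun j => σ j ^ 4)) := by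
      rw [le_div_iff₀ (by positivity)]
      linarith
    rw [Real.log_inv β] at this hL
    linarith
  have hm : MeasurableSet {y : Fin N → ℝ | (lowSum N D fun j => y j ^ 2) ≤ t} :=
    measurableSet_le (measurable_lowSum_sq N D) measurable_const
  rw [ENNReal.ofReal_lt_iff_lt_toReal (by linarith) (measure_ne_top _ _), gaussP_lt_lowSum_sq,
    ← prob_compl_eq_one_sub hm, ← measureReal_def, probReal_compl_eq_one_sub hm]
  linarith

/-- A powerful level-`α` test bounds the minimax rate. -/
lemma minimaxRate_sq_le {N : ℕ} {σ : Fin N → ℝ} {F : Set (Fin N → ℝ)} {α β R : ℝ} (hR : 0 < R)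
    {Φ : (Fin N → ℝ) → Bool} (hΦ : IsLevelTest N σ α Φ)
    (h : ∀ θ ∈ F, R ≤ l2norm N θ ^ 2 →
      ENNReal.ofReal (1 - β) < gaussP N σ θ {y | Φ y = true}) :
    minimaxRate N σ F α β ^ 2 ≤ ENNReal.ofReal R := by
  have hsep : sepRate N σ Φ F β ≤ ENNReal.ofReal (√R) := by
    refine sInf_le ⟨by simpa using hR, fun θ hθ hle => h θ hθ ?_⟩
    rw [ENNReal.ofReal_le_ofReal_iff (show 0 ≤ l2norm N θ from Real.sqrt_nonneg _)] at hle
    calc R = √R ^ 2 := (Real.sq_sqrt hR.le).symm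
      _ ≤ _ := by gcongr
  have hmin : minimaxRate N σ F α β ≤ ENNReal.ofReal (√R) :=
    le_trans (sInf_le (show _ ∈ {r | _} from ⟨Φ, hΦ, rfl⟩)) hsep
  calc _ ≤ ENNReal.ofReal (√R) ^ 2 := by gcongr
    _ = _ := by rw [← ENNReal.ofReal_pow (Real.sqrt_nonneg _), Real.sq_sqrt hR.le]

end Power

/-- Proposition 2: the chi-square test `1{Σ_{j=1}^D Y_j² > t_{D,1-α}(σ)}` has exact level `α`
and the corresponding upper bound for the minimax rate of testing over `S_D` in the `l₂` norm,
with an absolute constant `C`. -/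
theorem stmt3 :
    ∃ C : ℝ, 0 < C ∧
      ∀ (N D : ℕ), 1 ≤ D → D ≤ N →
      ∀ (σ : Fin N → ℝ), (∀ j, 0 < σ j) →
      ∀ (α β : ℝ), 0 < α → α < 1 → 0 < β → β < 1 →
      ∀ t : ℝ,
        -- `t` is the `1-α` quantile of `Σ_{j=1}^D σ_j² ε_j²`
        gaussP N σ 0 {y | t ≤ lowSum N D fun j => y j ^ 2} = ENNReal.ofReal α →
        -- the test has exact level `α`
        (gaussP N σ 0 {y | t < lowSum N D fun j => y j ^ 2} = ENNReal.ofReal α) ∧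
        -- power of the test on `S_D`
        (∀ θ ∈ SD N D,
          C * (Real.log β⁻¹ + Real.log α⁻¹ + Real.sqrt (Real.log α⁻¹) +
              Real.sqrt (Real.log β⁻¹)) * Real.sqrt (lowSum N D fun j => σ j ^ 4)
            ≤ (l2norm N θ) ^ 2 →
          ENNReal.ofReal (1 - β) < gaussP N σ θ {y | t < lowSum N D fun j => y j ^ 2}) ∧
        -- consequence for the minimax rate of testing over `S_D`
        (minimaxRate N σ (SD N D) α β) ^ 2 ≤
          ENNReal.ofReal (C * (Real.log β⁻¹ + Real.log α⁻¹ + Real.sqrt (Real.log α⁻¹) +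
            Real.sqrt (Real.log β⁻¹)) * Real.sqrt (lowSum N D fun j => σ j ^ 4)) := by
  refine ⟨12, by norm_num, fun N D hD hDN σ hσ α β hα hα1 hβ hβ1 t ht => ?_⟩
  have hm := measurable_lowSum_sq N D
  have hlevel : gaussP N σ 0 {y | t < lowSum N D fun j => y j ^ 2} = ENNReal.ofReal α := by
    rw [← ht, ← measure_sdiff_null (s := {y | t ≤ lowSum N D fun j => y j ^ 2})
      (gaussP_lowSum_sq_eq hD hDN hσ 0 t)]
    congr 1
    ext y
    simp [lt_iff_le_and_ne, ne_comm]
  have hs := Real.sqrt_pos.2 (lowSum_pow_four_pos hD hDN hσ)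
  have hlogα : 0 < Real.log α⁻¹ := Real.log_pos ((one_lt_inv₀ hα).2 hα1)
  have hlogβ : 0 < Real.log β⁻¹ := Real.log_pos ((one_lt_inv₀ hβ).2 hβ1)
  have hpower : ∀ θ ∈ SD N D,
      12 * (Real.log β⁻¹ + Real.log α⁻¹ + Real.sqrt (Real.log α⁻¹) +
        Real.sqrt (Real.log β⁻¹)) * Real.sqrt (lowSum N D fun j => σ j ^ 4) ≤ (l2norm N θ) ^ 2 →
      ENNReal.ofReal (1 - β) < gaussP N σ θ {y | t < lowSum N D fun j => y j ^ 2} := by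
    intro θ hθ hle
    refine ofReal_lt_gaussP_lowSum_sq hD hDN hσ hα hβ hβ1 ht hlevel ?_
    rw [← l2norm_sq_eq_lowSum hθ]
    refine le_trans ?_ hle
    refine mul_le_mul_of_nonneg_right ?_ hs.le
    linarith [Real.sqrt_nonneg (Real.log α⁻¹), Real.sqrt_nonneg (Real.log β⁻¹)]
  refine ⟨hlevel, hpower, ?_⟩
  refine minimaxRate_sq_le (Φ := fun y => decide (t < lowSum N D fun j => y j ^ 2))
    (by positivity) ⟨?_, by simpa using hlevel.le⟩ (by simpa using hpower)
  exact measurable_to_bool (by simpa [Set.preimage] using measurableSet_lt measurable_const hm)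
end
end
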